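/- Let m ≥ 2, K ≥ 0, and fix change points 0 = x₀ ≤ x₁ ≤ … ≤ x_K ≤ x_{K+1} = 1 with associated sign function χ_x. Suppose g : ℝ → ℝ is (m+1) times continuously differentiable on [0,1] and satisfies: g^(j)(0) = 0 for j = 0,…,m−2; χ_x(t) g^(m+1)(t) ≥ 0 for all t ∈ [0,1]; χ_x(1) g^(m)(1) ≤ 0; and χ_x(0)·[ g^(m−1)(0) − g^(m)(0) ] ≤ 0. Then for every f : ℝ → ℝ that is m times continuously differentiable on [0,1] with (−1)^{k−1} f^(m−1)(t) ≥ 0 for all t ∈ [x_{k−1}, x_k] and all k = 1,…,K+1, one has ⟪g,f⟫ ≤ 0; that is, g belongs to the negative polar cone of V^{K,m−1}[x]. -/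

import Mathlib

open Classical in
/-- Sign function `χ_x` associated to change points `0 = x 0 ≤ x 1 ≤ … ≤ x K ≤ x (K+1) = 1`:
`χ_x t = (-1)^k` for `x k < t < x (k+1)` (`k = 0, …, K`), `χ_x` vanishes at interior change
points, and at the endpoints `0` and `1` it takes the sign of the adjacent nondegenerate
interval. -/
noncomputable def chgSign (K : ℕ) (x : ℕ → ℝ) (t : ℝ) : ℝ :=
  if h : ∃ k, k ≤ K ∧ x k < t ∧ t < x (k + 1) then (-1 : ℝ) ^ Nat.find h
  else if t = 0 then
    if h0 : ∃ k, k ≤ K ∧ (0 : ℝ) < x (k + 1) then (-1 : ℝ) ^ Nat.find h0 else 0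
  else if t = 1 then
    if h1 : ∃ j, j ≤ K ∧ x (K - j) < 1 then (-1 : ℝ) ^ (K - Nat.find h1) else 0
  else 0

/-- The duality pairing `⟪g,f⟫ = ∑_{j<m} g^(j)(0) f^(j)(0) + ∫₀¹ f^(m)(t) g^(m)(t) dt`. -/
noncomputable def dualPairing (m : ℕ) (g f : ℝ → ℝ) : ℝ :=
  (∑ j ∈ Finset.range m,
      iteratedDerivWithin j g (Set.Icc 0 1) 0 * iteratedDerivWithin j f (Set.Icc 0 1) 0)
    + ∫ t in (0 : ℝ)..1,
        iteratedDerivWithin m f (Set.Icc 0 1) t * iteratedDerivWithin m g (Set.Icc 0 1) t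

/-- At a point outside the range of the change points, or at an endpoint of `[0,1]`, the sign
function is `(-1)^k` for an index `k` of a subinterval containing the point. -/
lemma exists_chgSign_eq_neg_one_pow {K : ℕ} {x : ℕ → ℝ} (hx0 : x 0 = 0) (hxK : x (K + 1) = 1)
    {t : ℝ} (ht : t ∈ Set.Icc (0 : ℝ) 1) (htx : t ∉ Set.range x ∨ t = 0 ∨ t = 1) :
    ∃ k ≤ K, t ∈ Set.Icc (x k) (x (k + 1)) ∧ chgSign K x t = (-1 : ℝ) ^ k := by
  classical
  unfold chgSign
  split_ifs with h h0 h1 h2 h3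
  · obtain ⟨hk, hl, hr⟩ := Nat.find_spec h
    exact ⟨_, hk, ⟨hl.le, hr.le⟩, by congr⟩
  · subst h0
    obtain ⟨hk, hr⟩ := Nat.find_spec h1
    refine ⟨_, hk, ⟨?_, hr.le⟩, by congr⟩
    rcases hn : Nat.find h1 with _ | n
    · exact hx0.le
    · have hmin := Nat.find_min h1 (m := n) (by omega)
      by_contra! hlt
      exact hmin ⟨by omega, hlt⟩
  · exact absurd ⟨K, le_rfl, by rw [hxK]; exact one_pos⟩ h1
  · subst h2
    obtain ⟨hk, hl⟩ := Nat.find_spec h3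
    refine ⟨_, Nat.sub_le K _, ⟨hl.le, ?_⟩, by congr⟩
    rcases hn : Nat.find h3 with _ | n
    · exact hxK.ge
    · have hmin := Nat.find_min h3 (m := n) (by omega)
      by_contra! hlt
      refine hmin ⟨by omega, ?_⟩
      rwa [show K - n = K - (n + 1) + 1 by omega]
  · exact absurd ⟨K, le_rfl, by simp [hx0]⟩ h3
  · have htx : t ∉ Set.range x := by tauto
    have hex : ∃ k, t < x (k + 1) :=
      ⟨K, by rw [hxK]; exact lt_of_le_of_ne ht.2 h2⟩
    refine absurd ⟨Nat.find hex, Nat.find_min' hex ?_, ?_, Nat.find_spec hex⟩ h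
    · rw [hxK]; exact lt_of_le_of_ne ht.2 h2
    · rcases hn : Nat.find hex with _ | n
      · rw [hx0]; exact lt_of_le_of_ne ht.1 (Ne.symm h0)
      · have hmin := Nat.find_min hex (m := n) (by omega)
        exact lt_of_le_of_ne (not_lt.1 hmin) fun e => htx ⟨_, e⟩

lemma ContDiffOn.hasDerivWithinAt_iteratedDerivWithin {f : ℝ → ℝ} {s : Set ℝ} {n : ℕ}
    (hf : ContDiffOn ℝ (n + 1) f s) (hs : UniqueDiffOn ℝ s) {t : ℝ} (ht : t ∈ s) :
    HasDerivWithinAt (iteratedDerivWithin n f s) (iteratedDerivWithin (n + 1) f s t) s t := by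
  rw [iteratedDerivWithin_succ]
  exact (hf.differentiableOn_iteratedDerivWithin
    (by exact_mod_cast Nat.lt_succ_self n) hs t ht).hasDerivWithinAt

/-- The pairing with a function whose derivatives of order less than `n` vanish at `0`, after
integrating by parts. -/
lemma dualPairing_succ_eq_sub_integral {n : ℕ} {f g : ℝ → ℝ}
    (hg : ContDiffOn ℝ (n + 2) g (Set.Icc 0 1)) (hf : ContDiffOn ℝ (n + 1) f (Set.Icc 0 1))
    (hg0 : ∀ j < n, iteratedDerivWithin j g (Set.Icc 0 1) 0 = 0) :
    dualPairing (n + 1) g f =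
      iteratedDerivWithin n f (Set.Icc 0 1) 0 * (iteratedDerivWithin n g (Set.Icc 0 1) 0 -
          iteratedDerivWithin (n + 1) g (Set.Icc 0 1) 0)
        + iteratedDerivWithin n f (Set.Icc 0 1) 1 * iteratedDerivWithin (n + 1) g (Set.Icc 0 1) 1
        - ∫ t in (0 : ℝ)..1, iteratedDerivWithin n f (Set.Icc 0 1) t *
            iteratedDerivWithin (n + 2) g (Set.Icc 0 1) t := by
  have hs : UniqueDiffOn ℝ (Set.Icc (0 : ℝ) 1) := uniqueDiffOn_Icc one_pos
  have hIcc : Set.uIcc (0 : ℝ) 1 = Set.Icc 0 1 := Set.uIcc_of_le zero_le_one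
  have hparts := intervalIntegral.integral_mul_deriv_eq_deriv_mul_of_hasDerivWithinAt
    (a := 0) (b := 1) (u := iteratedDerivWithin n f (Set.Icc 0 1))
    (u' := iteratedDerivWithin (n + 1) f (Set.Icc 0 1))
    (v := iteratedDerivWithin (n + 1) g (Set.Icc 0 1))
    (v' := iteratedDerivWithin (n + 2) g (Set.Icc 0 1))
    (fun t ht => by
      rw [hIcc] at ht ⊢
      exact hf.hasDerivWithinAt_iteratedDerivWithin hs ht)
    (fun t ht => by
      rw [hIcc] at ht ⊢
      exact ContDiffOn.hasDerivWithinAt_iteratedDerivWithin (n := n + 1)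
        (hg.of_le (by norm_cast)) hs ht)
    (ContinuousOn.intervalIntegrable (by
      rw [hIcc]
      exact hf.continuousOn_iteratedDerivWithin (by norm_cast) hs))
    (ContinuousOn.intervalIntegrable (by
      rw [hIcc]
      exact hg.continuousOn_iteratedDerivWithin (by norm_cast) hs))
  rw [dualPairing, Finset.sum_range_succ, Finset.sum_eq_zero fun j hj => by
    rw [hg0 j (Finset.mem_range.1 hj), zero_mul], hparts]
  ring

/-- Membership in the negative polar cone of `V^{K,m-1}[x]`:
if `g ∈ C^{m+1}[0,1]` satisfies `g^(j)(0) = 0` for `j ≤ m-2`, `χ_x g^(m+1) ≥ 0` on `[0,1]`,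
`χ_x(1) g^(m)(1) ≤ 0` and `χ_x(0)(g^(m-1)(0) - g^(m)(0)) ≤ 0`, then `⟪g,f⟫ ≤ 0` for every
`f ∈ C^m[0,1]` with `(-1)^{k-1} f^(m-1) ≥ 0` on `[x_{k-1}, x_k]` for all `k`. -/
theorem negative_polar_membership_ell_m_sub_one (m K : ℕ) (hm : 2 ≤ m)
    (x : ℕ → ℝ) (hx0 : x 0 = 0) (hxK : x (K + 1) = 1)
    (hmono : ∀ k ≤ K, x k ≤ x (k + 1))
    (g : ℝ → ℝ) (hg : ContDiffOn ℝ (m + 1) g (Set.Icc 0 1))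
    (hg0 : ∀ j ≤ m - 2, iteratedDerivWithin j g (Set.Icc 0 1) 0 = 0)
    (hga : ∀ t ∈ Set.Icc (0 : ℝ) 1,
      0 ≤ chgSign K x t * iteratedDerivWithin (m + 1) g (Set.Icc 0 1) t)
    (hgb : chgSign K x 1 * iteratedDerivWithin m g (Set.Icc 0 1) 1 ≤ 0)
    (hgc : chgSign K x 0 *
      (iteratedDerivWithin (m - 1) g (Set.Icc 0 1) 0 -
        iteratedDerivWithin m g (Set.Icc 0 1) 0) ≤ 0) :
    ∀ f : ℝ → ℝ, ContDiffOn ℝ m f (Set.Icc 0 1) →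
      (∀ k ≤ K, ∀ t ∈ Set.Icc (x k) (x (k + 1)),
        0 ≤ (-1 : ℝ) ^ k * iteratedDerivWithin (m - 1) f (Set.Icc 0 1) t) →
      dualPairing m g f ≤ 0 := by
  intro f hf hfV
  obtain ⟨n, rfl⟩ : ∃ n, m = n + 1 := ⟨m - 1, by omega⟩
  simp only [Nat.add_sub_cancel] at hgc hfV
  have key : ∀ t ∈ Set.Icc (0 : ℝ) 1, t ∉ Set.range x ∨ t = 0 ∨ t = 1 → ∀ c : ℝ,
      0 ≤ chgSign K x t * c → 0 ≤ iteratedDerivWithin n f (Set.Icc 0 1) t * c := by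
    intro t ht htx c hc
    obtain ⟨k, hk, hkt, hs⟩ := exists_chgSign_eq_neg_one_pow hx0 hxK ht htx
    rw [hs] at hc
    have hprod := mul_nonneg (hfV k hk t hkt) hc
    rwa [mul_mul_mul_comm, ← mul_pow, neg_one_mul, neg_neg, one_pow, one_mul] at hprod
  rw [dualPairing_succ_eq_sub_integral (hg.of_le (by norm_cast))
    (by exact_mod_cast hf) fun j hj => hg0 j (by omega)]
  have h0 := key 0 (by simp) (by simp) _ (by rw [mul_neg]; exact neg_nonneg.2 hgc)
  have h1 := key 1 (by simp) (by simp) _ (by rw [mul_neg]; exact neg_nonneg.2 hgb)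
  have hint : 0 ≤ ∫ t in (0 : ℝ)..1, iteratedDerivWithin n f (Set.Icc 0 1) t *
      iteratedDerivWithin (n + 2) g (Set.Icc 0 1) t := by
    refine intervalIntegral.integral_nonneg_of_ae_restrict zero_le_one ?_
    filter_upwards [MeasureTheory.ae_restrict_mem measurableSet_Icc,
      MeasureTheory.ae_restrict_of_ae ((Set.countable_range x).ae_notMem _)] with t ht htx
    exact key t ht (.inl htx) _ (hga t ht)
  linarith
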